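/- Let n ≥ 1, let X be an n×n real symmetric positive definite matrix with X ≠ I, and let β̄ ∈ (0,1). Then there exists a constant c > 0 such that for every β ∈ (0, β̄], (1/β)·log det((1−β)·I + β·X) − log det X ≥ c. -/

import Mathlib

open Matrix

/-- Concavity of the logarithm along the segment from `1` to `y`. -/
lemma mul_log_le_log_segment {t y : ℝ} (ht0 : 0 ≤ t) (ht1 : t ≤ 1) (hy : 0 < y) :
    t * Real.log y ≤ Real.log (1 - t + t * y) := by
  have h := strictConcaveOn_log_Ioi.concaveOn.2 (Set.mem_Ioi.2 one_pos) (Set.mem_Ioi.2 hy)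
    (sub_nonneg.2 ht1) ht0 (sub_add_cancel 1 t)
  simpa using h

/-- Strict concavity of the logarithm along the segment from `1` to `y ≠ 1`. -/
lemma mul_log_lt_log_segment {t y : ℝ} (ht0 : 0 < t) (ht1 : t < 1) (hy : 0 < y) (hy1 : y ≠ 1) :
    t * Real.log y < Real.log (1 - t + t * y) := by
  have h := strictConcaveOn_log_Ioi.2 (Set.mem_Ioi.2 one_pos) (Set.mem_Ioi.2 hy)
    hy1.symm (sub_pos.2 ht1) ht0 (sub_add_cancel 1 t)
  simpa using h

/-- The determinant of an affine combination of the identity and a symmetric matrix. -/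
lemma Matrix.IsHermitian.det_smul_one_add_smul {ι : Type*} [Fintype ι] [DecidableEq ι]
    {A : Matrix ι ι ℝ} (hA : A.IsHermitian) (a b : ℝ) :
    (a • (1 : Matrix ι ι ℝ) + b • A).det = ∏ i, (a + b * hA.eigenvalues i) := by
  have h : a • (1 : Matrix ι ι ℝ) + b • A = Unitary.conjStarAlgAut ℝ _ hA.eigenvectorUnitary
      (diagonal fun i => a + b * hA.eigenvalues i) := by
    have hd : (diagonal fun i => a + b * hA.eigenvalues i) =
        a • (1 : Matrix ι ι ℝ) + b • diagonal (RCLike.ofReal ∘ hA.eigenvalues) := by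
      ext i j
      by_cases hij : i = j <;> simp [hij]
    rw [hd, map_add, map_smul, map_smul, map_one, ← hA.spectral_theorem]
  rw [h, Unitary.conjStarAlgAut_apply, det_mul_comm, ← mul_assoc]
  simp

/-- A symmetric matrix other than the identity has an eigenvalue other than `1`. -/
lemma Matrix.IsHermitian.exists_eigenvalues_ne_one {ι : Type*} [Fintype ι] [DecidableEq ι]
    {A : Matrix ι ι ℝ} (hA : A.IsHermitian) (hA1 : A ≠ 1) : ∃ i, hA.eigenvalues i ≠ 1 := by
  by_contra! h
  apply hA1
  have hd : diagonal (RCLike.ofReal ∘ hA.eigenvalues) = (1 : Matrix ι ι ℝ) := by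
    rw [← diagonal_one]
    congr 1
    ext i
    simp [h]
  rw [hA.spectral_theorem, hd, map_one]

/-- For a symmetric positive definite `X ≠ I` and `β̄ ∈ (0,1)`, there is `c > 0`
such that for all `β ∈ (0, β̄]`,
`(1/β)·log det((1−β)·I + β·X) − log det X ≥ c`. -/
theorem stmt4 (n : ℕ) (hn : 1 ≤ n) (X : Matrix (Fin n) (Fin n) ℝ)
    (hX : X.PosDef) (hX1 : X ≠ 1) (βbar : ℝ) (hβbar : βbar ∈ Set.Ioo (0 : ℝ) 1) :
    ∃ c > 0, ∀ β ∈ Set.Ioc (0 : ℝ) βbar,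
      c ≤ (1 / β) * Real.log ((1 - β) • (1 : Matrix (Fin n) (Fin n) ℝ) + β • X).det
            - Real.log X.det := by
  obtain ⟨hb0, hb1⟩ := hβbar
  set l := hX.1.eigenvalues
  have hl : ∀ i, 0 < l i := hX.eigenvalues_pos
  have hpos : ∀ β : ℝ, 0 < β → β < 1 → ∀ i, 0 < 1 - β + β * l i := fun β h0 h1 i =>
    add_pos (sub_pos.2 h1) (mul_pos h0 (hl i))
  have hlog : ∀ β : ℝ, 0 < β → β < 1 →
      Real.log ((1 - β) • (1 : Matrix (Fin n) (Fin n) ℝ) + β • X).det =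
        ∑ i, Real.log (1 - β + β * l i) := fun β h0 h1 => by
    rw [hX.1.det_smul_one_add_smul, Real.log_prod fun i _ => (hpos β h0 h1 i).ne']
  have hlogX : Real.log X.det = ∑ i, Real.log (l i) := by
    rw [hX.1.det_eq_prod_eigenvalues]
    exact Real.log_prod fun i _ => (hl i).ne'
  refine ⟨(1 / βbar) * ∑ i, Real.log (1 - βbar + βbar * l i) - ∑ i, Real.log (l i), ?_, ?_⟩
  · obtain ⟨j, hj⟩ := hX.1.exists_eigenvalues_ne_one hX1
    have h : ∑ i, βbar * Real.log (l i) < ∑ i, Real.log (1 - βbar + βbar * l i) :=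
      Finset.sum_lt_sum (fun i _ => mul_log_le_log_segment hb0.le hb1.le (hl i))
        ⟨j, Finset.mem_univ j, mul_log_lt_log_segment hb0 hb1 (hl j) hj⟩
    rw [← Finset.mul_sum] at h
    rw [gt_iff_lt, sub_pos, one_div_mul_eq_div, lt_div_iff₀ hb0, mul_comm]
    exact h
  · rintro β ⟨h0, h1⟩
    rw [hlog β h0 (h1.trans_lt hb1), hlogX, Finset.mul_sum, Finset.mul_sum]
    refine sub_le_sub_right (Finset.sum_le_sum fun i _ => ?_) _
    have h := mul_log_le_log_segment (div_nonneg h0.le hb0.le) ((div_le_one hb0).2 h1)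
      (hpos βbar hb0 hb1 i)
    have he : 1 - β / βbar + β / βbar * (1 - βbar + βbar * l i) = 1 - β + β * l i := by
      field_simp
      ring
    rw [he] at h
    rw [one_div_mul_eq_div β, le_div_iff₀ h0]
    exact le_of_eq_of_le (by ring) h
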